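/- Let A be a set, let g : (ℚ ∩ [0,∞)) × A × A → ℝ be a function, and let (A_x)_{x∈A} be a family of subsets of A such that A_x ∩ A_{x'} is nonempty for all x, x' ∈ A, and such that for every s, t ∈ ℚ ∩ [0,∞), every x, y ∈ A, and every z ∈ A_x, one has g(t+s, x, y) = g(s, x, z) + g(t, z, y). Suppose further that there is a function b : A → ℝ with g(0, x, y) = b(x) − b(y) for all x, y ∈ A. Then there exists λ ∈ ℝ such that for all t ∈ ℚ ∩ [0,∞), all x ∈ A, and all z ∈ A_x, one has g(t, x, z) = λ·t + b(x) − b(z). -/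

import Mathlib

theorem cocycle_linear {A : Type*} (g : ℚ → A → A → ℝ) (As : A → Set A) (b : A → ℝ)
    (hA : ∀ x x' : A, (As x ∩ As x').Nonempty)
    (hadd : ∀ s t : ℚ, 0 ≤ s → 0 ≤ t → ∀ x y : A, ∀ z ∈ As x,
      g (t + s) x y = g s x z + g t z y)
    (h0 : ∀ x y : A, g 0 x y = b x - b y) :
    ∃ lam : ℝ, ∀ t : ℚ, 0 ≤ t → ∀ x : A, ∀ z ∈ As x,
      g t x z = lam * (t : ℝ) + b x - b z := by
  rcases isEmpty_or_nonempty A with hE | ⟨⟨a⟩⟩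
  · exact ⟨0, fun t _ x => (hE.false x).elim⟩
  -- the normalized cocycle depends neither on the endpoint nor on the starting point
  have hy : ∀ t : ℚ, 0 ≤ t → ∀ x y y' : A, g t x y + b y = g t x y' + b y' := by
    intro t ht x y y'
    obtain ⟨z, hz, -⟩ := hA x x
    have h1 := hadd t 0 ht le_rfl x y z hz
    have h2 := hadd t 0 ht le_rfl x y' z hz
    rw [zero_add, h0] at h1 h2
    linarith
  have hx : ∀ t : ℚ, 0 ≤ t → ∀ x x' y : A, g t x y - b x = g t x' y - b x' := by
    intro t ht x x' y
    obtain ⟨z, hz, hz'⟩ := hA x x'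
    have h1 := hadd 0 t le_rfl ht x y z hz
    have h2 := hadd 0 t le_rfl ht x' y z hz'
    rw [add_zero, h0] at h1 h2
    linarith
  have hf : ∀ s t : ℚ, 0 ≤ s → 0 ≤ t → g (t + s) a a = g s a a + g t a a := by
    intro s t hs ht
    obtain ⟨z, hz, -⟩ := hA a a
    have h1 := hadd s t hs ht a a z hz
    have h2 := hy s hs a a z
    have h3 := hx t ht a z a
    linarith
  have hn : ∀ (n : ℕ) (t : ℚ), 0 ≤ t → g (n * t) a a = n * g t a a := by
    intro n t ht
    induction n with
    | zero => simp [h0]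
    | succ k ih =>
      have h1 := hf t (k * t) ht (by positivity)
      push_cast
      rw [add_mul, one_mul, h1, ih]
      ring
  refine ⟨g 1 a a, fun t ht x z _ => ?_⟩
  have hlin : g t a a = g 1 a a * (t : ℝ) := by
    have h1 := hn t.den t ht
    have h2 := hn t.num.toNat 1 zero_le_one
    have hnum : ((t.num.toNat : ℕ) : ℚ) = t.num := by
      exact_mod_cast Int.toNat_of_nonneg (Rat.num_nonneg.2 ht)
    have hq : (t.den : ℚ) * t = (t.num.toNat : ℚ) * 1 := by
      rw [hnum, mul_one, Rat.den_mul_eq_num]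
    have hr : (t.den : ℝ) * (t : ℝ) = (t.num.toNat : ℝ) := by
      have := congrArg (fun q : ℚ => (q : ℝ)) hq
      push_cast at this
      simpa using this
    rw [hq, h2, ← hr] at h1
    have hd : (t.den : ℝ) ≠ 0 := by exact_mod_cast t.den_nz
    apply mul_left_cancel₀ hd
    linarith
  have h1 := hy t ht x z a
  have h2 := hx t ht x a a
  linarith
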